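/- Let V, r, par be a finite rooted tree, let a be an integer weight function on it, and fix marked nodes M ⊆ V and guesses g : V → ℤ satisfying conditions (i)–(iii) of a well-spread guess assignment. Then for every node v with w(v) > a(v), some strict descendant of v is heavy. -/

import Mathlib

open scoped Classical

/-- The depth of a node other than the root exceeds the depth of its parent by one. -/
lemma sInf_iterate_eq_succ {V : Type*} {r : V} {par : V → V}
    (htree : ∀ v : V, ∃ k : ℕ, par^[k] v = r) {c : V} (hc : c ≠ r) :
    sInf {k : ℕ | par^[k] c = r} = sInf {k : ℕ | par^[k] (par c) = r} + 1 := by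
  apply le_antisymm
  · exact Nat.sInf_le (Nat.sInf_mem (htree (par c)) : par^[_] (par c) = r)
  · have h : par^[sInf {k : ℕ | par^[k] c = r}] c = r := Nat.sInf_mem (htree c)
    cases hn : sInf {k : ℕ | par^[k] c = r} with
    | zero => rw [hn] at h; exact absurd h hc
    | succ n =>
      rw [hn] at h
      exact Nat.succ_le_succ (Nat.sInf_le h)

/-- A node is at most as deep as any of its descendants. -/
lemma sInf_iterate_le_of_iterate_eq {V : Type*} {r : V} {par : V → V} (hroot : par r = r)
    (htree : ∀ v : V, ∃ k : ℕ, par^[k] v = r) {u v : V} {k : ℕ} (h : par^[k] u = v) :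
    sInf {k : ℕ | par^[k] v = r} ≤ sInf {k : ℕ | par^[k] u = r} := by
  have hu : par^[sInf {k : ℕ | par^[k] u = r}] u = r := Nat.sInf_mem (htree u)
  refine Nat.sInf_le (?_ : par^[_] v = r)
  rw [← h, ← Function.iterate_add_apply, add_comm, Function.iterate_add_apply, hu,
    Function.iterate_fixed hroot]

/-- A strict descendant of a node is a descendant of one of its children. -/
lemma exists_child_of_iterate_eq {V : Type*} {r : V} {par : V → V} (hroot : par r = r)
    {u v : V} (huv : u ≠ v) (h : ∃ k : ℕ, par^[k] u = v) :
    ∃ c, (c ≠ r ∧ par c = v) ∧ ∃ k : ℕ, par^[k] u = c := by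
  obtain ⟨k, hk⟩ := h
  induction k generalizing u with
  | zero => exact absurd hk huv
  | succ n ih =>
    by_cases hp : par u = v
    · refine ⟨u, ⟨?_, hp⟩, 0, rfl⟩
      rintro rfl
      exact huv (hroot.symm.trans hp)
    · obtain ⟨c, hc, m, hm⟩ := ih hp hk
      exact ⟨c, hc, m + 1, hm⟩

/-- The marked strict descendants of a node are counted by the marked descendants of its
children. -/
lemma card_strict_descendants_le_sum {V : Type*} [Fintype V] {r : V} {par : V → V}
    (hroot : par r = r) (M : Finset V) (v : V) :
    (M.filter (fun u => u ≠ v ∧ ∃ k : ℕ, par^[k] u = v)).card ≤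
      ∑ c ∈ Finset.univ.filter (fun c => c ≠ r ∧ par c = v),
        (M.filter (fun u => ∃ k : ℕ, par^[k] u = c)).card := by
  refine le_trans (Finset.card_le_card fun u hu => ?_) Finset.card_biUnion_le
  obtain ⟨huM, huv, hk⟩ := Finset.mem_filter.mp hu
  obtain ⟨c, hc, hcu⟩ := exists_child_of_iterate_eq hroot huv hk
  exact Finset.mem_biUnion.mpr ⟨c, by simpa using hc, Finset.mem_filter.mpr ⟨huM, hcu⟩⟩

/-- Forgetting the node itself loses at most one marked descendant, and none if the node is
unmarked. -/
lemma card_descendants_le {V : Type*} (par : V → V) (M : Finset V) (v : V) :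
    (M.filter (fun u => ∃ k : ℕ, par^[k] u = v)).card ≤
      (M.filter (fun u => u ≠ v ∧ ∃ k : ℕ, par^[k] u = v)).card + if v ∈ M then 1 else 0 := by
  have herase : M.filter (fun u => u ≠ v ∧ ∃ k : ℕ, par^[k] u = v) =
      (M.filter (fun u => ∃ k : ℕ, par^[k] u = v)).erase v := by
    ext u
    simp only [Finset.mem_filter, Finset.mem_erase]
    tauto
  rw [herase]
  split_ifs with hv
  · exact Nat.sub_le_iff_le_add.mp Finset.pred_card_le_card_erase
  · rw [Finset.erase_eq_of_notMem (by simp [hv]), add_zero]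

/-- If a node has at least as many marked strict descendants as its weight, then one of its
strict descendants is heavy. -/
lemma exists_heavy_of_le_card_strict_descendants
    {V : Type*} [Fintype V] {r : V} {par : V → V} (hroot : par r = r)
    (htree : ∀ v : V, ∃ k : ℕ, par^[k] v = r) {a : V → ℤ} (ha : ∀ v, 1 ≤ a v)
    (hsum : ∀ v : V,
      (∑ u ∈ Finset.univ.filter (fun u => u ≠ r ∧ par u = v), a u) ≤ a v)
    {M : Finset V} {g : V → ℤ}
    (honly : ∀ v ∈ M, v ≠ r → (∀ u : V, u ≠ r → par u = par v → u = v) → g v = a v)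
    (hspread : ∀ u ∈ M, ∀ v ∈ M,
      sInf {k : ℕ | par^[k] u = r} = sInf {k : ℕ | par^[k] v = r} → u = v)
    (v : V)
    (hv : a v ≤ ((M.filter (fun u => u ≠ v ∧ ∃ k : ℕ, par^[k] u = v)).card : ℤ)) :
    ∃ v' : V, v' ≠ v ∧ (∃ k : ℕ, par^[k] v' = v) ∧ v' ∈ M ∧
      g v' ≤ ((M.filter (fun u => ∃ k : ℕ, par^[k] u = v')).card : ℤ) := by
  obtain ⟨N, hN⟩ := (Set.finite_range fun v => sInf {k : ℕ | par^[k] v = r}).bddAbove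
  replace hN : ∀ v, sInf {k : ℕ | par^[k] v = r} ≤ N := fun v => hN ⟨v, rfl⟩
  induction hm : N - sInf {k : ℕ | par^[k] v = r} using Nat.strong_induction_on
    generalizing v with
  | _ m ih =>
  have hdepth : ∀ c, c ≠ r → par c = v →
      sInf {k : ℕ | par^[k] c = r} = sInf {k : ℕ | par^[k] v = r} + 1 := by
    rintro c hc rfl
    exact sInf_iterate_eq_succ htree hc
  have hne : ∀ c, c ≠ r → par c = v → ∀ u k, par^[k] u = c → u ≠ v := by
    rintro c hc hcv u k hk rfl
    have := sInf_iterate_le_of_iterate_eq hroot htree hk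
    have := hdepth c hc hcv
    omega
  have descend : ∀ c, c ≠ r → par c = v →
      a c ≤ ((M.filter (fun u => u ≠ c ∧ ∃ k : ℕ, par^[k] u = c)).card : ℤ) →
      ∃ v' : V, v' ≠ v ∧ (∃ k : ℕ, par^[k] v' = v) ∧ v' ∈ M ∧
        g v' ≤ ((M.filter (fun u => ∃ k : ℕ, par^[k] u = v')).card : ℤ) := by
    intro c hc hcv hac
    have hd := hdepth c hc hcv
    have hNc := hN c
    obtain ⟨v', -, ⟨k, hk⟩, hM, hg⟩ := ih _ (by omega) c hac rfl
    refine ⟨v', hne c hc hcv v' k hk, ⟨k + 1, ?_⟩, hM, hg⟩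
    rw [Function.iterate_succ_apply', hk, hcv]
  by_cases hex : ∃ c, (c ≠ r ∧ par c = v) ∧
      a c < ((M.filter (fun u => ∃ k : ℕ, par^[k] u = c)).card : ℤ)
  · obtain ⟨c, ⟨hc, hcv⟩, hlt⟩ := hex
    apply descend c hc hcv
    have := card_descendants_le par M c
    split_ifs at this <;> omega
  push Not at hex
  have hle := card_strict_descendants_le_sum hroot M v
  have hle' : a v ≤ ∑ c ∈ Finset.univ.filter (fun c => c ≠ r ∧ par c = v),
      ((M.filter (fun u => ∃ k : ℕ, par^[k] u = c)).card : ℤ) :=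
    hv.trans (mod_cast hle)
  have hall : ∀ c ∈ Finset.univ.filter (fun c => c ≠ r ∧ par c = v),
      ((M.filter (fun u => ∃ k : ℕ, par^[k] u = c)).card : ℤ) ≤ a c :=
    fun c hc => hex c (Finset.mem_filter.mp hc).2
  have heq := (Finset.sum_eq_sum_iff_of_le hall).mp
    (le_antisymm (Finset.sum_le_sum hall) ((hsum v).trans hle'))
  obtain ⟨c, hcmem⟩ : (Finset.univ.filter (fun c => c ≠ r ∧ par c = v)).Nonempty := by
    rw [Finset.nonempty_iff_ne_empty]
    intro h
    rw [h, Finset.sum_empty] at hle'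
    linarith [ha v]
  by_cases hunm : ∃ c, (c ≠ r ∧ par c = v) ∧ c ∉ M
  · obtain ⟨c, ⟨hc, hcv⟩, hcM⟩ := hunm
    apply descend c hc hcv
    have h1 := heq c (by simp [hc, hcv])
    have h2 := card_descendants_le par M c
    rw [if_neg hcM] at h2
    omega
  push Not at hunm
  have hc := (Finset.mem_filter.mp hcmem).2
  refine ⟨c, hne c hc.1 hc.2 c 0 rfl, ⟨1, hc.2⟩, hunm c hc, ?_⟩
  rw [heq c hcmem]
  refine (honly c (hunm c hc) hc.1 fun u hu huc => ?_).le
  have huv : par u = v := huc.trans hc.2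
  refine hspread u (hunm u ⟨hu, huv⟩) c (hunm c hc) ?_
  rw [hdepth u hu huv, hdepth c hc.1 hc.2]

/-- Lemma C.2 (xl:limit): in a well-spread assignment of guesses, if `w v > a v`,
then some strict descendant of `v` is heavy. -/
theorem exists_heavy_strict_descendant
    {V : Type*} [Fintype V]
    (r : V) (par : V → V) (hroot : par r = r)
    (htree : ∀ v : V, ∃ k : ℕ, par^[k] v = r)
    (a : V → ℤ)
    (ha : ∀ v, 1 ≤ a v)
    (hsum : ∀ v : V,
      (∑ u ∈ Finset.univ.filter (fun u => u ≠ r ∧ par u = v), a u) ≤ a v)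
    (M : Finset V) (g : V → ℤ)
    -- (i) guesses never underestimate
    (hge : ∀ v ∈ M, a v ≤ g v)
    -- (ii) guesses are exact on only children
    (honly : ∀ v ∈ M, v ≠ r → (∀ u : V, u ≠ r → par u = par v → u = v) → g v = a v)
    -- (iii) well-spread: distinct marked nodes have distinct depths
    (hspread : ∀ u ∈ M, ∀ v ∈ M,
      sInf {k : ℕ | par^[k] u = r} = sInf {k : ℕ | par^[k] v = r} → u = v) :
    ∀ v : V,
      a v < ((M.filter (fun u => ∃ k : ℕ, par^[k] u = v)).card : ℤ) →
      ∃ v' : V, v' ≠ v ∧ (∃ k : ℕ, par^[k] v' = v) ∧ v' ∈ M ∧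
        g v' ≤ ((M.filter (fun u => ∃ k : ℕ, par^[k] u = v')).card : ℤ) := by
  intro v hv
  apply exists_heavy_of_le_card_strict_descendants hroot htree ha hsum honly hspread
  have := card_descendants_le par M v
  split_ifs at this <;> omega
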